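/- arXiv:1607.01202 — 7 statements merged into one kernel-verified Lean document; each statement's English description precedes it below -/
import Mathlib

section
/- Feasibility and switching point of the two-phase exploration trajectory: Let c_g = 1 + √2, m̄ > 0 and S > 0. Set t̄₁ = √(2·m̄·S/(2c_g + 1)) and T = (2c_g + 1)·t̄₁ = √(2·m̄·S·(2c_g + 1)). The trajectory x with x(t) = t²/(2m̄) on [0, t̄₁] and x(t) = S/(2c_g + 1) + (t̄₁/m̄)·(t − t̄₁) − (t − t̄₁)²/(4·c_g·m̄) on [t̄₁, T] is continuously differentiable with acceleration +1/m̄ on the first phase and −1/(2·c_g·m̄) on the second phase, satisfies x(0) = 0, x'(0) = 0, switches at position x(t̄₁) = S/(2c_g + 1) = S/(3 + 2√2), and terminates at rest at the target: x(T) = S and x'(T) = 0. -/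
/-!
Feasibility and switching point of the two-phase exploration trajectory: with
`c_g = 1 + √2`, `t̄₁ = √(2m̄S/(2c_g+1))` and `T = (2c_g+1)·t̄₁`, the trajectory with
acceleration `+1/m̄` on `[0, t̄₁]` and `−1/(2c_g·m̄)` on `[t̄₁, T]` is continuously
differentiable, starts at rest at `0`, switches at position `S/(2c_g+1) = S/(3+2√2)`,
respects the unit control bound, and terminates at rest at the target `S`.
-/

/-- The retrieval-cost constant `c_g = 1 + √2`. -/
noncomputable def cg : ℝ := 1 + Real.sqrt 2

/-- Gluing two differentiable functions whose values and derivatives agree at `a`. -/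
lemma HasDerivAt.ite_le {f g f' g' : ℝ → ℝ} {a : ℝ} (hf : ∀ t, HasDerivAt f (f' t) t)
    (hg : ∀ t, HasDerivAt g (g' t) t) (h : f a = g a) (h' : f' a = g' a) (t : ℝ) :
    HasDerivAt (fun t => if t ≤ a then f t else g t) (if t ≤ a then f' t else g' t) t := by
  rcases lt_trichotomy t a with hlt | rfl | hgt
  · rw [if_pos hlt.le]
    refine (hf t).congr_of_eventuallyEq ?_
    filter_upwards [Iio_mem_nhds hlt] with u hu
    exact if_pos (le_of_lt hu)
  · rw [if_pos le_rfl, ← hasDerivWithinAt_univ, ← Set.Iic_union_Ici (a := t)]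
    refine HasDerivWithinAt.union ?_ ?_
    · exact (hf t).hasDerivWithinAt.congr (fun u hu => if_pos hu) (if_pos le_rfl)
    · rw [h']
      have hr : ∀ u ∈ Set.Ici t, (if u ≤ t then f u else g u) = g u := by
        intro u hu
        split_ifs with hut
        · rw [le_antisymm hut hu, h]
        · rfl
      exact (hg t).hasDerivWithinAt.congr hr (hr t Set.self_mem_Ici)
  · rw [if_neg hgt.not_ge]
    refine (hg t).congr_of_eventuallyEq ?_
    filter_upwards [Ioi_mem_nhds hgt] with u hu
    exact if_neg (not_le_of_gt hu)

/-- A two-piece affine function with slopes `w` and `-d`, where `0 ≤ d ≤ w`, is `w`-Lipschitz. -/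
lemma abs_ite_affine_sub_le {a w d : ℝ} (hd : 0 ≤ d) (hdw : d ≤ w) (s t : ℝ) :
    |(if t ≤ a then t * w else a * w - (t - a) * d) -
      (if s ≤ a then s * w else a * w - (s - a) * d)| ≤ |t - s| * w := by
  have key : ∀ s t : ℝ, s ≤ t →
      |(if t ≤ a then t * w else a * w - (t - a) * d) -
        (if s ≤ a then s * w else a * w - (s - a) * d)| ≤ |t - s| * w := by
    intro s t hst
    rw [abs_of_nonneg (sub_nonneg.2 hst), abs_le]
    split_ifs with h1 h2 h2
    · constructor <;> nlinarith
    · linarith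
    · constructor <;> nlinarith
    · constructor <;> nlinarith
  rcases le_total s t with h | h
  · exact key s t h
  · rw [abs_sub_comm, abs_sub_comm t s]
    exact key t s h

theorem two_phase_exploration_feasibility (m S : ℝ) (hm : 0 < m) (hS : 0 < S)
    (t1 T : ℝ) (x v : ℝ → ℝ)
    (ht1 : t1 = Real.sqrt (2 * m * S / (2 * cg + 1)))
    (hT : T = (2 * cg + 1) * t1)
    (hx : x = fun t => if t ≤ t1 then t ^ 2 / (2 * m)
      else S / (2 * cg + 1) + (t1 / m) * (t - t1) - (t - t1) ^ 2 / (4 * cg * m))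
    (hv : v = fun t => if t ≤ t1 then t / m else t1 / m - (t - t1) / (2 * cg * m)) :
    T = Real.sqrt (2 * m * S * (2 * cg + 1)) ∧
    (∀ t ∈ Set.Icc (0 : ℝ) T, HasDerivAt x (v t) t) ∧
    ContinuousOn v (Set.Icc 0 T) ∧
    (∀ t ∈ Set.Ioo (0 : ℝ) t1, HasDerivAt v (1 / m) t) ∧
    (∀ t ∈ Set.Ioo t1 T, HasDerivAt v (-(1 / (2 * cg * m))) t) ∧
    (∀ s ∈ Set.Icc (0 : ℝ) T, ∀ t ∈ Set.Icc (0 : ℝ) T, |v t - v s| ≤ |t - s| / m) ∧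
    x 0 = 0 ∧ v 0 = 0 ∧
    x t1 = S / (2 * cg + 1) ∧ S / (2 * cg + 1) = S / (3 + 2 * Real.sqrt 2) ∧
    x T = S ∧ v T = 0 := by
  have hc : 0 < cg := by unfold cg; positivity
  have hc1 : 1 ≤ cg := by
    unfold cg
    linarith [Real.sqrt_nonneg 2]
  have hk : 0 < 2 * cg + 1 := by positivity
  have ht1pos : 0 < t1 := by rw [ht1]; positivity
  have hsq : t1 ^ 2 = 2 * m * S / (2 * cg + 1) := by
    rw [ht1, Real.sq_sqrt (by positivity)]
  have hsq' : t1 ^ 2 / (2 * m) = S / (2 * cg + 1) := by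
    rw [hsq]
    field_simp
  have hlt : t1 < T := by rw [hT]; nlinarith
  have hTt : T - t1 = 2 * cg * t1 := by rw [hT]; ring
  have hder : ∀ t, HasDerivAt x (v t) t := by
    intro t
    rw [hx, hv]
    refine HasDerivAt.ite_le (f := fun t => t ^ 2 / (2 * m))
      (g := fun t => S / (2 * cg + 1) + (t1 / m) * (t - t1) - (t - t1) ^ 2 / (4 * cg * m))
      (f' := fun t => t / m) (g' := fun t => t1 / m - (t - t1) / (2 * cg * m))
      (fun u => ?_) (fun u => ?_) ?_ ?_ t
    · refine (((hasDerivAt_id' u).pow 2).div_const (2 * m)).congr_deriv ?_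
      field_simp
      norm_num
    · have h1 := (hasDerivAt_id' u).sub_const t1
      refine (((h1.const_mul (t1 / m)).const_add (S / (2 * cg + 1))).sub
        ((h1.pow 2).div_const (4 * cg * m))).congr_deriv ?_
      field_simp
      norm_num
      ring
    · simp [hsq']
    · simp
  have hlip : ∀ s t, |v t - v s| ≤ |t - s| / m := by
    intro s t
    have hd : (2 * cg * m)⁻¹ ≤ m⁻¹ := inv_anti₀ hm (by nlinarith)
    simpa only [hv, div_eq_mul_inv] using
      abs_ite_affine_sub_le (a := t1) (inv_nonneg.2 (by positivity)) hd s t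
  have hcont : Continuous v := by
    rw [hv]
    refine Continuous.if_le (by fun_prop) (by fun_prop) continuous_id continuous_const ?_
    rintro u rfl
    simp
  refine ⟨?_, fun t _ => hder t, hcont.continuousOn, ?_, ?_, fun s _ t _ => hlip s t,
    ?_, ?_, ?_, ?_, ?_, ?_⟩
  · rw [eq_comm, Real.sqrt_eq_iff_mul_self_eq (by positivity) (ht1pos.trans hlt).le, hT]
    have : (2 * cg + 1) * t1 * ((2 * cg + 1) * t1) = (2 * cg + 1) ^ 2 * t1 ^ 2 := by ring
    rw [this, hsq]
    field_simp
  · intro t ht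
    refine ((hasDerivAt_id t).div_const m).congr_of_eventuallyEq ?_
    filter_upwards [Iio_mem_nhds ht.2] with u hu
    simp only [hv, if_pos (Set.mem_Iio.1 hu).le, id]
  · intro t ht
    refine ((((hasDerivAt_id t).sub_const t1).div_const (2 * cg * m)).const_sub
      (t1 / m)).congr_of_eventuallyEq ?_
    filter_upwards [Ioi_mem_nhds ht.1] with u hu
    simp only [hv, if_neg (Set.mem_Ioi.1 hu).not_ge, id]
  · simp [hx, ht1pos.le]
  · simp [hv, ht1pos.le]
  · simp [hx, hsq']
  · unfold cg
    ring_nf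
  · simp only [hx, if_neg hlt.not_ge, hTt]
    have : t1 / m * (2 * cg * t1) - (2 * cg * t1) ^ 2 / (4 * cg * m)
        = 2 * cg * (t1 ^ 2 / (2 * m)) := by
      field_simp
      ring
    rw [add_sub_assoc, this, hsq']
    field_simp
    ring
  · simp only [hv, if_neg hlt.not_ge, hTt]
    field_simp
    ring
end

section
/- Minimum-time lower bound for rest-to-rest motion of a one-dimensional double integrator: Let m > 0 and d > 0. Suppose T ≥ 0 and x : ℝ → ℝ is differentiable on [0, T] with derivative v, where |v(t) − v(s)| ≤ |t − s|/m for all s, t ∈ [0, T], and x(0) = 0, v(0) = 0, x(T) = d, v(T) = 0. Then T ≥ 2·√(m·d). -/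
/-!
Minimum-time lower bound for rest-to-rest motion of a one-dimensional double
integrator with mass `m > 0` and unit-bounded force: any trajectory from rest at `0`
to rest at `d > 0` whose velocity satisfies the Lipschitz bound
`|v(t) − v(s)| ≤ |t − s|/m` takes time at least `2·√(m·d)`.
-/

theorem sub_le_sub_of_hasDerivAt_le {f g f' g' : ℝ → ℝ} {a b : ℝ} (hab : a ≤ b)
    (hf : ∀ t ∈ Set.Icc a b, HasDerivAt f (f' t) t)
    (hg : ∀ t ∈ Set.Icc a b, HasDerivAt g (g' t) t)
    (hle : ∀ t ∈ Set.Icc a b, f' t ≤ g' t) :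
    f b - f a ≤ g b - g a := by
  have hderiv : ∀ t ∈ Set.Icc a b, HasDerivAt (fun t => g t - f t) (g' t - f' t) t :=
    fun t ht => (hg t ht).sub (hf t ht)
  have hmono : MonotoneOn (fun t => g t - f t) (Set.Icc a b) :=
    monotoneOn_of_hasDerivWithinAt_nonneg (convex_Icc a b)
      (fun t ht => (hderiv t ht).continuousAt.continuousWithinAt)
      (fun t ht => (hderiv t (interior_subset ht)).hasDerivWithinAt)
      (fun t ht => sub_nonneg.2 (hle t (interior_subset ht)))
  have := hmono (Set.left_mem_Icc.2 hab) (Set.right_mem_Icc.2 hab) hab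
  dsimp only at this
  linarith

theorem double_integrator_rest_to_rest_lower_bound (m d : ℝ) (hm : 0 < m) (hd : 0 < d)
    (T : ℝ) (hT : 0 ≤ T) (x v : ℝ → ℝ)
    (hx : ∀ t ∈ Set.Icc (0 : ℝ) T, HasDerivAt x (v t) t)
    (hlip : ∀ s ∈ Set.Icc (0 : ℝ) T, ∀ t ∈ Set.Icc (0 : ℝ) T, |v t - v s| ≤ |t - s| / m)
    (hx0 : x 0 = 0) (hv0 : v 0 = 0) (hxT : x T = d) (hvT : v T = 0) :
    2 * Real.sqrt (m * d) ≤ T := by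
  have hfirst : x (T / 2) - x 0 ≤ (T / 2) ^ 2 / (2 * m) - 0 ^ 2 / (2 * m) := by
    refine sub_le_sub_of_hasDerivAt_le (f' := v) (g := fun t => t ^ 2 / (2 * m))
      (g' := fun t => t / m) (by linarith)
      (fun t ht => hx t ⟨ht.1, by linarith [ht.2]⟩) (fun t _ => ?_) (fun t ht => ?_)
    · refine ((hasDerivAt_pow 2 t).div_const (2 * m)).congr_deriv ?_
      field_simp
      norm_num
    · have h := hlip 0 ⟨le_rfl, hT⟩ t ⟨ht.1, by linarith [ht.2]⟩
      rw [hv0, sub_zero, sub_zero, abs_of_nonneg ht.1] at h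
      exact (le_abs_self _).trans h
  have hsecond : x T - x (T / 2) ≤ -((T - T) ^ 2 / (2 * m)) - -((T - T / 2) ^ 2 / (2 * m)) := by
    refine sub_le_sub_of_hasDerivAt_le (f' := v) (g := fun t => -((T - t) ^ 2 / (2 * m)))
      (g' := fun t => (T - t) / m) (by linarith)
      (fun t ht => hx t ⟨by linarith [ht.1], ht.2⟩) (fun t _ => ?_) (fun t ht => ?_)
    · refine ((((hasDerivAt_id t).const_sub T).pow 2).div_const (2 * m)).neg.congr_deriv ?_
      simp only [id]
      field_simp
      norm_num [mul_comm]
    · have h := hlip T ⟨hT, le_rfl⟩ t ⟨by linarith [ht.1], ht.2⟩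
      rw [hvT, sub_zero, abs_sub_comm, abs_of_nonneg (sub_nonneg.2 ht.2)] at h
      exact (le_abs_self _).trans h
  have hdist : d ≤ T ^ 2 / (4 * m) := by
    have hsum : (T / 2) ^ 2 / (2 * m) + (T - T / 2) ^ 2 / (2 * m) = T ^ 2 / (4 * m) := by
      field_simp
      ring
    simp only [sub_self, ne_eq, OfNat.ofNat_ne_zero, not_false_eq_true, zero_pow, zero_div]
      at hfirst hsecond
    linarith
  rw [le_div_iff₀ (by positivity)] at hdist
  have hsqrt : Real.sqrt (m * d) ≤ T / 2 :=
    Real.sqrt_le_iff.2 ⟨by linarith, by linarith⟩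
  linarith
end

section
/- Minimum-time lower bound for rest-to-rest motion of a planar double integrator: Let m > 0 and let a, b ∈ ℝ² (Euclidean plane). Suppose T ≥ 0 and y : ℝ → ℝ² is differentiable on [0, T] with derivative w, where ‖w(t) − w(s)‖ ≤ |t − s|/m for all s, t ∈ [0, T] (Euclidean norm), and y(0) = a, w(0) = 0, y(T) = b, w(T) = 0. Then T ≥ 2·√(m·‖b − a‖). -/
/-!
Minimum-time lower bound for rest-to-rest motion of a planar double integrator with
mass `m > 0` and unit-bounded force: any trajectory from rest at `a ∈ ℝ²` to rest at
`b ∈ ℝ²` whose velocity satisfies the Lipschitz bound `‖w(t) − w(s)‖ ≤ |t − s|/m`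
takes time at least `2·√(m·‖b − a‖)`.
-/

/-- If the speed of `y` on `[p, q]` is bounded by the derivative of `B`, then the displacement
of `y` is bounded by the increment of `B`. -/
theorem norm_sub_le_sub_of_norm_deriv_le {E : Type*} [NormedAddCommGroup E] [NormedSpace ℝ E]
    {y w : ℝ → E} {B B' : ℝ → ℝ} {p q : ℝ} (hpq : p ≤ q)
    (hy : ∀ t ∈ Set.Icc p q, HasDerivAt y (w t) t) (hB : ∀ t, HasDerivAt B (B' t) t)
    (hw : ∀ t ∈ Set.Icc p q, ‖w t‖ ≤ B' t) : ‖y q - y p‖ ≤ B q - B p :=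
  image_norm_le_of_norm_deriv_right_le_deriv_boundary (f := fun t => y t - y p)
    (B := fun t => B t - B p)
    (fun t ht => ((hy t ht).sub_const _).continuousAt.continuousWithinAt)
    (fun t ht => ((hy t (Set.Ico_subset_Icc_self ht)).sub_const _).hasDerivWithinAt)
    (by simp) (fun t => (hB t).sub_const _)
    (fun t ht => hw t (Set.Ico_subset_Icc_self ht)) (Set.right_mem_Icc.2 hpq)

theorem planar_double_integrator_rest_to_rest_lower_bound (m : ℝ) (hm : 0 < m)
    (a b : EuclideanSpace ℝ (Fin 2)) (T : ℝ) (hT : 0 ≤ T)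
    (y w : ℝ → EuclideanSpace ℝ (Fin 2))
    (hy : ∀ t ∈ Set.Icc (0 : ℝ) T, HasDerivAt y (w t) t)
    (hlip : ∀ s ∈ Set.Icc (0 : ℝ) T, ∀ t ∈ Set.Icc (0 : ℝ) T, ‖w t - w s‖ ≤ |t - s| / m)
    (hy0 : y 0 = a) (hw0 : w 0 = 0) (hyT : y T = b) (hwT : w T = 0) :
    2 * Real.sqrt (m * ‖b - a‖) ≤ T := by
  have h_first : ‖y (T / 2) - y 0‖ ≤ (T / 2) ^ 2 / (2 * m) - 0 ^ 2 / (2 * m) := by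
    refine norm_sub_le_sub_of_norm_deriv_le (w := w) (B := fun t => t ^ 2 / (2 * m))
      (B' := fun t => t / m) (by linarith) (fun t ht => hy t ⟨ht.1, by linarith [ht.2]⟩)
      (fun t => ?_) fun t ht => ?_
    · refine ((hasDerivAt_pow 2 t).div_const (2 * m)).congr_deriv ?_
      field_simp
      norm_num
    · have h := hlip 0 ⟨le_rfl, hT⟩ t ⟨ht.1, by linarith [ht.2]⟩
      rwa [hw0, sub_zero, sub_zero, abs_of_nonneg ht.1] at h
  have h_second : ‖y T - y (T / 2)‖ ≤
      -(T - T) ^ 2 / (2 * m) - -(T - T / 2) ^ 2 / (2 * m) := by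
    refine norm_sub_le_sub_of_norm_deriv_le (w := w) (B := fun t => -(T - t) ^ 2 / (2 * m))
      (B' := fun t => (T - t) / m) (by linarith) (fun t ht => hy t ⟨by linarith [ht.1], ht.2⟩)
      (fun t => ?_) fun t ht => ?_
    · refine ((((hasDerivAt_id t).const_sub T).pow 2).neg.div_const (2 * m)).congr_deriv ?_
      simp only [id]
      field_simp
      norm_num [mul_comm]
    · have h := hlip T ⟨hT, le_rfl⟩ t ⟨by linarith [ht.1], ht.2⟩
      rwa [hwT, sub_zero, abs_sub_comm, abs_of_nonneg (sub_nonneg.2 ht.2)] at h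
  have h_total : ‖b - a‖ ≤ T ^ 2 / (4 * m) := by
    rw [← hyT, ← hy0]
    calc ‖y T - y 0‖ ≤ ‖y T - y (T / 2)‖ + ‖y (T / 2) - y 0‖ := norm_sub_le_norm_sub_add_norm_sub ..
      _ ≤ _ := add_le_add h_second h_first
      _ = T ^ 2 / (4 * m) := by field_simp; ring
  have h_sqrt : √(m * ‖b - a‖) ≤ T / 2 := by
    rw [Real.sqrt_le_left (by linarith)]
    rw [le_div_iff₀ (by positivity)] at h_total
    linarith
  linarith
end

section
/- Minimum-time lower bound for returning to the detection point (pick-up after detection at speed v₀): Let m̄ > 0 and v₀ > 0. Suppose T ≥ 0 and x : ℝ → ℝ is differentiable on [0, T] with derivative v, where |v(t) − v(s)| ≤ |t − s|/m̄ for all s, t ∈ [0, T], and x(0) = 0, v(0) = v₀, x(T) = 0, v(T) = 0. Then T ≥ (1 + √2)·m̄·v₀. -/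
/-!
Minimum-time lower bound for returning to the detection point: a one-dimensional
double integrator with effective mass `m̄ > 0` and unit-bounded force that starts at
position `0` with speed `v₀ > 0` and must come to rest again at position `0` needs
time at least `(1 + √2)·m̄·v₀`.
-/

theorem le_of_hasDerivAt_nonneg_Icc {f f' : ℝ → ℝ} {a b : ℝ} (hab : a ≤ b)
    (hf : ∀ t ∈ Set.Icc a b, HasDerivAt f (f' t) t) (hf' : ∀ t ∈ Set.Icc a b, 0 ≤ f' t) :
    f a ≤ f b :=
  monotoneOn_of_hasDerivWithinAt_nonneg (convex_Icc a b)
    (fun t ht => (hf t ht).continuousAt.continuousWithinAt)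
    (fun t ht => (hf t (interior_subset ht)).hasDerivWithinAt)
    (fun t ht => hf' t (interior_subset ht))
    (Set.left_mem_Icc.2 hab) (Set.right_mem_Icc.2 hab) hab

theorem return_to_detection_point_lower_bound (m v0 : ℝ) (hm : 0 < m) (hv0 : 0 < v0)
    (T : ℝ) (hT : 0 ≤ T) (x v : ℝ → ℝ)
    (hx : ∀ t ∈ Set.Icc (0 : ℝ) T, HasDerivAt x (v t) t)
    (hlip : ∀ s ∈ Set.Icc (0 : ℝ) T, ∀ t ∈ Set.Icc (0 : ℝ) T, |v t - v s| ≤ |t - s| / m)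
    (hx0 : x 0 = 0) (hvinit : v 0 = v0) (hxT : x T = 0) (hvT : v T = 0) :
    (1 + Real.sqrt 2) * m * v0 ≤ T := by
  have h0 : (0 : ℝ) ∈ Set.Icc 0 T := Set.left_mem_Icc.2 hT
  have h1 : T ∈ Set.Icc 0 T := Set.right_mem_Icc.2 hT
  have hlow_start : ∀ t ∈ Set.Icc 0 T, m * v0 - t ≤ m * v t := by
    intro t ht
    have h := (abs_le.1 (hlip 0 h0 t ht)).1
    rw [sub_zero, abs_of_nonneg ht.1, hvinit, ← neg_div, div_le_iff₀ hm] at h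
    linarith
  have hlow_end : ∀ t ∈ Set.Icc 0 T, -(T - t) ≤ m * v t := by
    intro t ht
    have h := (abs_le.1 (hlip t ht T h1)).2
    rw [abs_of_nonneg (sub_nonneg.2 ht.2), hvT, le_div_iff₀ hm] at h
    linarith
  have hTa : m * v0 ≤ T := by
    have h := hlow_start T h1
    rw [hvT] at h
    linarith
  obtain ⟨s, hs⟩ : ∃ s, s = (T + m * v0) / 2 := ⟨_, rfl⟩
  have hs0 : 0 ≤ s := by linarith [mul_pos hm hv0]
  have hsT : s ≤ T := by linarith
  have hx_start : m * v0 * s - s ^ 2 / 2 ≤ m * x s := by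
    have h := le_of_hasDerivAt_nonneg_Icc
      (f := fun t => m * x t - (m * v0 * t - t ^ 2 / 2))
      (f' := fun t => m * v t - (m * v0 - t)) hs0
      (fun t ht => by
        have hd := ((hx t ⟨ht.1, ht.2.trans hsT⟩).const_mul m).sub
          (((hasDerivAt_id t).const_mul (m * v0)).sub (((hasDerivAt_id t).pow 2).div_const 2))
        refine HasDerivAt.congr_deriv hd ?_
        simp)
      (fun t ht => sub_nonneg.2 (hlow_start t ⟨ht.1, ht.2.trans hsT⟩))
    simp only [hx0] at h
    linarith
  have hx_end : m * x s ≤ (T - s) ^ 2 / 2 := by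
    have h := le_of_hasDerivAt_nonneg_Icc
      (f := fun t => m * x t - (T - t) ^ 2 / 2)
      (f' := fun t => m * v t + (T - t)) hsT
      (fun t ht => by
        have hd := ((hx t ⟨hs0.trans ht.1, ht.2⟩).const_mul m).sub
          ((((hasDerivAt_id t).const_sub T).pow 2).div_const 2)
        refine HasDerivAt.congr_deriv hd ?_
        simp
        ring)
      (fun t ht => by linarith [hlow_end t ⟨hs0.trans ht.1, ht.2⟩])
    simp only [hxT] at h
    linarith
  have hquad : 2 * (m * v0) ^ 2 ≤ (T - m * v0) ^ 2 := by
    subst hs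
    nlinarith
  have hroot : Real.sqrt 2 * (m * v0) ≤ T - m * v0 := by
    refine (abs_le_of_sq_le_sq' ?_ (sub_nonneg.2 hTa)).2
    rwa [mul_pow, Real.sq_sqrt zero_le_two]
  linarith
end

section
/- Lower bound for the cost of a pick-up/drop-off string (equation (8) of the paper, lower-bound direction): Let d ≥ 1, let m₁, …, m_d > 0 be the robot masses on the successive legs, and let y₀, y₁, …, y_d ∈ ℝ² be the successive waypoints. Suppose t₀ ≤ t₁ ≤ … ≤ t_d are times and y : ℝ → ℝ² is differentiable with derivative w such that for each i ∈ {1, …, d} the Lipschitz bound ‖w(t) − w(s)‖ ≤ |t − s|/m_i holds for all s, t ∈ [t_{i−1}, t_i], and y(t_i) = y_i with w(t_i) = 0 for every i ∈ {0, 1, …, d}. Then t_d − t₀ ≥ Σ_{i=1}^{d} 2·√(m_i·‖y_i − y_{i−1}‖). -/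
/-!
Lower bound for the cost of a pick-up/drop-off string (equation (8) of the paper,
lower-bound direction): a planar double-integrator robot with unit-bounded force,
whose mass on the `i`-th leg is `m i`, visiting the waypoints `y₀, …, y_d` in order
and at rest at each waypoint, needs total time at least
`Σᵢ 2·√(m i·‖yᵢ − yᵢ₋₁‖)`.
-/

/-- A rest-to-rest motion on `[a, b]` whose velocity is `1 / m`-Lipschitz takes time at least
`2 * √(m * D)`, where `D` is the distance between its endpoints. -/
theorem two_mul_sqrt_le_of_rest_to_rest {E : Type*} [NormedAddCommGroup E] [NormedSpace ℝ E]
    {a b m : ℝ} (hab : a ≤ b) (hm : 0 < m) {Y w : ℝ → E}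
    (hY : ∀ s ∈ Set.Icc a b, HasDerivAt Y (w s) s)
    (hlip : ∀ s ∈ Set.Icc a b, ∀ r ∈ Set.Icc a b, ‖w r - w s‖ ≤ |r - s| / m)
    (ha : w a = 0) (hb : w b = 0) :
    2 * Real.sqrt (m * ‖Y b - Y a‖) ≤ b - a := by
  obtain ⟨c, hc⟩ : ∃ c, c = (a + b) / 2 := ⟨_, rfl⟩
  have hac : a ≤ c := by linarith
  have hcb : c ≤ b := by linarith
  have hsub : ∀ s ∈ Set.Icc a b, HasDerivAt (fun x => Y x - Y a) (w s) s :=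
    fun s hs => (hY s hs).sub_const _
  have hcont : ContinuousOn (fun x => Y x - Y a) (Set.Icc a b) :=
    fun s hs => (hsub s hs).continuousAt.continuousWithinAt
  have accelerate : ‖Y c - Y a‖ ≤ (c - a) ^ 2 / (2 * m) := by
    refine image_norm_le_of_norm_deriv_right_le_deriv_boundary
      (f := fun x => Y x - Y a) (f' := w) (a := a) (b := c)
      (B := fun x => (x - a) ^ 2 / (2 * m)) (B' := fun x => (x - a) / m)
      (hcont.mono (Set.Icc_subset_Icc_right hcb))
      (fun x hx => (hsub x ⟨hx.1, by linarith [hx.2]⟩).hasDerivWithinAt)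
      (by simp) (fun x => ?_) (fun x hx => ?_) (Set.right_mem_Icc.2 hac)
    · refine (((hasDerivAt_id x).sub_const a).pow 2).div_const (2 * m) |>.congr_deriv ?_
      simp
      field_simp
    · have h := hlip a ⟨le_rfl, hab⟩ x ⟨hx.1, by linarith [hx.2]⟩
      rwa [ha, sub_zero, abs_of_nonneg (by linarith [hx.1])] at h
  have total : ‖Y b - Y a‖ ≤ (b - a) ^ 2 / (4 * m) - (b - b) ^ 2 / (2 * m) := by
    refine image_norm_le_of_norm_deriv_right_le_deriv_boundary
      (f := fun x => Y x - Y a) (f' := w) (a := c) (b := b)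
      (B := fun x => (b - a) ^ 2 / (4 * m) - (b - x) ^ 2 / (2 * m))
      (B' := fun x => (b - x) / m)
      (hcont.mono (Set.Icc_subset_Icc_left hac))
      (fun x hx => (hsub x ⟨by linarith [hx.1], hx.2.le⟩).hasDerivWithinAt)
      (accelerate.trans_eq ?_) (fun x => ?_) (fun x hx => ?_) (Set.right_mem_Icc.2 hcb)
    · rw [hc]
      field_simp
      ring
    · refine ((((hasDerivAt_id x).const_sub b).pow 2).div_const (2 * m)).const_sub
        ((b - a) ^ 2 / (4 * m)) |>.congr_deriv ?_
      simp
      field_simp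
    · have h := hlip b ⟨hab, le_rfl⟩ x ⟨by linarith [hx.1], hx.2.le⟩
      rwa [hb, sub_zero, abs_sub_comm, abs_of_nonneg (by linarith [hx.2])] at h
  have hsq : m * ‖Y b - Y a‖ ≤ ((b - a) / 2) ^ 2 := by
    refine (mul_le_mul_of_nonneg_left total hm.le).trans_eq ?_
    field_simp
    ring
  linarith [Real.sqrt_le_iff.2 ⟨by linarith, hsq⟩]

theorem string_cost_lower_bound (d : ℕ) (hd : 1 ≤ d)
    (m : Fin d → ℝ) (hm : ∀ i, 0 < m i)
    (ypts : Fin (d + 1) → EuclideanSpace ℝ (Fin 2))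
    (t : Fin (d + 1) → ℝ) (hmono : Monotone t)
    (Y w : ℝ → EuclideanSpace ℝ (Fin 2))
    (hY : ∀ s ∈ Set.Icc (t 0) (t (Fin.last d)), HasDerivAt Y (w s) s)
    (hlip : ∀ i : Fin d, ∀ s ∈ Set.Icc (t i.castSucc) (t i.succ),
      ∀ r ∈ Set.Icc (t i.castSucc) (t i.succ), ‖w r - w s‖ ≤ |r - s| / m i)
    (hwp : ∀ j, Y (t j) = ypts j) (hrest : ∀ j, w (t j) = 0) :
    ∑ i : Fin d, 2 * Real.sqrt (m i * ‖ypts i.succ - ypts i.castSucc‖) ≤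
      t (Fin.last d) - t 0 := by
  have telescope : ∀ (n : ℕ) (u : Fin (n + 1) → ℝ),
      ∑ i : Fin n, (u i.succ - u i.castSucc) = u (Fin.last n) - u 0 := by
    intro n u
    rw [Finset.sum_sub_distrib]
    linarith [Fin.sum_univ_succ u, Fin.sum_univ_castSucc u]
  rw [← telescope d t]
  refine Finset.sum_le_sum fun i _ => ?_
  rw [← hwp, ← hwp]
  refine two_mul_sqrt_le_of_rest_to_rest (hmono (Fin.castSucc_le_succ i)) (hm i)
    (fun s hs => hY s ⟨?_, ?_⟩) (hlip i) (hrest _) (hrest _)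
  · exact (hmono (Fin.zero_le _)).trans hs.1
  · exact hs.2.trans (hmono (Fin.le_last _))
end

section
/- Singular-arc control value (from the proof of Theorem 1): Let c_g = 1 + √2 and m̄ > 0. Suppose on an open interval (t_a, t_b) the differentiable functions x₂, x₃, λ₁, λ₂ : (t_a, t_b) → ℝ and a function u : (t_a, t_b) → ℝ satisfy the state and costate equations x₂'(t) = u(t)/m̄, x₃'(t) = 1, λ₁'(t) = 0, λ₂'(t) = −(2·c_g·m̄·x₂(t) + x₃(t) + λ₁(t)), and λ₂(t) = 0 for all t ∈ (t_a, t_b). Then u(t) = −1/(2·c_g) = −1/(2 + 2√2) for all t ∈ (t_a, t_b). -/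
theorem cg_pos : 0 < cg := by
  unfold cg
  positivity

/-- A function vanishing on an open set has zero derivative there. -/
theorem HasDerivAt.eq_zero_of_forall_mem_isOpen {f : ℝ → ℝ} {f' t : ℝ} {s : Set ℝ}
    (hf : HasDerivAt f f' t) (hs : IsOpen s) (ht : t ∈ s) (h : ∀ x ∈ s, f x = 0) :
    f' = 0 := by
  have h0 : f =ᶠ[nhds t] fun _ => 0 := by
    filter_upwards [hs.mem_nhds ht] with x hx using h x hx
  exact hf.unique ((hasDerivAt_const t (0 : ℝ)).congr_of_eventuallyEq h0)

theorem singular_arc_control_value (m : ℝ) (hm : 0 < m)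
    (ta tb : ℝ) (hab : ta < tb)
    (x2 x3 l1 l2 : ℝ → ℝ) (u : ℝ → ℝ)
    (hx2 : ∀ t ∈ Set.Ioo ta tb, HasDerivAt x2 (u t / m) t)
    (hx3 : ∀ t ∈ Set.Ioo ta tb, HasDerivAt x3 1 t)
    (hl1 : ∀ t ∈ Set.Ioo ta tb, HasDerivAt l1 0 t)
    (hl2 : ∀ t ∈ Set.Ioo ta tb,
      HasDerivAt l2 (-(2 * cg * m * x2 t + x3 t + l1 t)) t)
    (hsing : ∀ t ∈ Set.Ioo ta tb, l2 t = 0) :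
    ∀ t ∈ Set.Ioo ta tb, u t = -(1 / (2 * cg)) := by
  intro t ht
  have hzero : ∀ x ∈ Set.Ioo ta tb, 2 * cg * m * x2 x + x3 x + l1 x = 0 := fun x hx =>
    neg_eq_zero.mp ((hl2 x hx).eq_zero_of_forall_mem_isOpen isOpen_Ioo hx hsing)
  have hderiv : HasDerivAt (fun x => 2 * cg * m * x2 x + x3 x + l1 x)
      (2 * cg * m * (u t / m) + 1 + 0) t :=
    (((hx2 t ht).const_mul (2 * cg * m)).add (hx3 t ht)).add (hl1 t ht)
  have h := hderiv.eq_zero_of_forall_mem_isOpen isOpen_Ioo ht hzero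
  have hc := cg_pos.ne'
  have hm' := hm.ne'
  field_simp at h ⊢
  linarith
end

section
/- Third switching time for the two-object trajectory (Appendix D): Let c_g = 1 + √2, m̄ > 0, s₁, s₂ ∈ ℝ, and let t₁ ≤ t₂ ≤ t₃ ≤ t₄ be real numbers satisfying the two relations −(t₄ − t₃)²/(4·c_g·m̄) + ((t₃ + 2t₁ − 2t₂)/m̄)·(t₄ − t₃) + ((t₃ − 3t₂ + 4t₁)/(2m̄))·(t₃ − t₂) + s₁ = s₂ and t₄ = (2·c_g + 1)·t₃ − 4·c_g·(t₂ − t₁). Then t₂² − 4·t₁·t₂ + 4·t₁² + 2·m̄·(s₂ − s₁) ≥ 0 and t₃ = 2·(t₂ − t₁) + √((t₂² − 4·t₁·t₂ + 4·t₁² + 2·m̄·(s₂ − s₁))/(2·c_g + 1)). -/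
theorem third_switching_time_two_objects (m s1 s2 t1 t2 t3 t4 : ℝ) (hm : 0 < m)
    (h12 : t1 ≤ t2) (h23 : t2 ≤ t3) (h34 : t3 ≤ t4)
    (heq1 : -(t4 - t3) ^ 2 / (4 * cg * m) + ((t3 + 2 * t1 - 2 * t2) / m) * (t4 - t3)
      + ((t3 - 3 * t2 + 4 * t1) / (2 * m)) * (t3 - t2) + s1 = s2)
    (heq2 : t4 = (2 * cg + 1) * t3 - 4 * cg * (t2 - t1)) :
    0 ≤ t2 ^ 2 - 4 * t1 * t2 + 4 * t1 ^ 2 + 2 * m * (s2 - s1) ∧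
    t3 = 2 * (t2 - t1) +
      Real.sqrt ((t2 ^ 2 - 4 * t1 * t2 + 4 * t1 ^ 2 + 2 * m * (s2 - s1)) / (2 * cg + 1)) := by
  have hc : 0 < cg := by unfold cg; positivity
  have hu : 0 ≤ t3 - 2 * (t2 - t1) := by
    have h : 0 ≤ cg * (t3 - 2 * (t2 - t1)) := by linarith
    exact nonneg_of_mul_nonneg_right h hc
  have hD : t2 ^ 2 - 4 * t1 * t2 + 4 * t1 ^ 2 + 2 * m * (s2 - s1)
      = (2 * cg + 1) * (t3 - 2 * (t2 - t1)) ^ 2 := by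
    rw [← heq1, heq2]
    field_simp
    ring
  rw [hD, mul_div_cancel_left₀ _ (by positivity), Real.sqrt_sq hu]
  exact ⟨by positivity, by ring⟩
end
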